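/- arXiv:1104.2007 — 5 statements merged into one kernel-verified Lean document; each statement's English description precedes it below -/
import Mathlib

section
/- Let K be a field, W a K-vector space of dimension N, and let p, q be positive integers with p + q > N. Let a_1, …, a_p and b_1, …, b_q be vectors of W and let ω : W^N → K be any alternating N-multilinear form. Then in the exterior power ∧^{p+q−N} W the following identity holds: Σ ε_{H|C} · ω(a_{h_1}, …, a_{h_{N−q}}, b_1, …, b_q) · a_{c_1} ∧ ⋯ ∧ a_{c_{p+q−N}} = Σ ε_{I|J} · ω(a_1, …, a_p, b_{j_1}, …, b_{j_{N−p}}) · b_{i_1} ∧ ⋯ ∧ b_{i_{p+q−N}}, where on the left the sum runs over all partitions of {1, …, p} into an increasing (N−q)-tuple H = (h_1 < … < h_{N−q}) and an increasing (p+q−N)-tuple C = (c_1 < … < c_{p+q−N}), and on the right the sum runs over all partitions of {1, …, q} into an increasing (p+q−N)-tuple I = (i_1 < … < i_{p+q−N}) and an increasing (N−p)-tuple J = (j_1 < … < j_{N−p}). The common value is called the meet T ∗ U of T = a_1 ∧ ⋯ ∧ a_p and U = b_1 ∧ ⋯ ∧ b_q with respect to ω. -/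
/-- `ε_{H|I}`: for disjoint finsets `H`, `I` of indices, the sign of the permutation sorting
the concatenation of the increasing enumeration of `H` followed by that of `I`, computed as
`(-1)` to the number of inversions between the two blocks. -/
def epsSign {N : ℕ} (H I : Finset (Fin N)) : ℤ :=
  (-1) ^ ((H ×ˢ I).filter fun x => x.2 < x.1).card

section

open Finset Matrix

theorem castAdd_lt_natAdd {p q : ℕ} (i : Fin p) (j : Fin q) :
    Fin.castAdd q i < Fin.natAdd p j := by
  simp only [Fin.lt_def, Fin.val_castAdd, Fin.val_natAdd]
  omega

theorem castAdd_lt_castAdd {p q : ℕ} {i j : Fin p} :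
    Fin.castAdd q i < Fin.castAdd q j ↔ i < j :=
  Iff.rfl

/-- The permutation listing `S` increasingly, followed by its complement. -/
def shufflePerm {N r n : ℕ} (hn : N + r = n) (S : Finset (Fin n)) (hS : #S = N) (hS' : #Sᶜ = r) :
    Equiv.Perm (Fin n) :=
  (finSumFinEquiv.trans (finCongr hn)).symm.trans (finSumEquivOfFinset hS hS')

theorem shufflePerm_lt_and_lt_iff {N r n : ℕ} (hn : N + r = n) (S : Finset (Fin n)) (hS : #S = N)
    (hS' : #Sᶜ = r) (i j : Fin n) :
    (i < j ∧ shufflePerm hn S hS hS' j < shufflePerm hn S hS hS' i) ↔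
      (shufflePerm hn S hS hS' i ∈ S ∧ shufflePerm hn S hS hS' j ∈ Sᶜ) ∧
        shufflePerm hn S hS hS' j < shufflePerm hn S hS hS' i := by
  obtain ⟨u, rfl⟩ := (finSumFinEquiv.trans (finCongr hn)).surjective i
  obtain ⟨w, rfl⟩ := (finSumFinEquiv.trans (finCongr hn)).surjective j
  have hin (t : Fin N) : S.orderEmbOfFin hS t ∈ S := orderEmbOfFin_mem _ _ _
  have hout (t : Fin r) : Sᶜ.orderEmbOfFin hS' t ∉ S :=
    mem_compl.1 (orderEmbOfFin_mem _ _ _)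
  simp only [shufflePerm, Equiv.trans_apply, Equiv.symm_trans_apply, Equiv.symm_apply_apply]
  rcases u with u | u <;> rcases w with w | w
  · simpa [hin] using fun h => h.le
  · simpa [hin] using fun _ => castAdd_lt_natAdd u w
  · simpa [hout] using fun h => absurd h (castAdd_lt_natAdd w u).not_gt
  · simpa [hout] using fun h => h.le

theorem sign_shufflePerm {N r n : ℕ} (hn : N + r = n) (S : Finset (Fin n)) (hS : #S = N)
    (hS' : #Sᶜ = r) :
    ((Equiv.Perm.sign (shufflePerm hn S hS hS') : ℤˣ) : ℤ) = epsSign S Sᶜ := by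
  set σ := shufflePerm hn S hS hS' with hσ
  have key : ((Equiv.Perm.sign σ : ℤˣ) : ℤ) =
      (-1) ^ #{x : Fin n × Fin n | x.1 < x.2 ∧ σ x.2 < σ x.1} := by
    rw [σ.sign_eq_prod_prod_Ioi, ← prod_const, prod_filter, ← univ_product_univ, prod_product,
      Units.coe_prod]
    refine prod_congr rfl fun i _ => ?_
    rw [Units.coe_prod, ← filter_lt_eq_Ioi, prod_filter]
    refine prod_congr rfl fun j _ => ?_
    by_cases hij : i < j
    · have : σ i ≠ σ j := fun h => hij.ne (σ.injective h)
      rcases lt_or_gt_of_ne this with h | h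
      · simp [hij, h, h.le]
      · simp [hij, h, h.le]
    · simp [hij]
  rw [key, epsSign]
  congr 1
  refine card_equiv (σ.prodCongr σ) fun x => ?_
  simpa using shufflePerm_lt_and_lt_iff hn S hS hS' x.1 x.2

variable {K : Type*} [Field K]

theorem det_piecewise_eq_zero {N r n : ℕ} (c : Fin N ⊕ Fin r ≃ Fin n) (S : Finset (Fin n))
    (hS : #S ≠ N) (x : Fin n → Fin N → K) (y : Fin n → Fin r → K) :
    (Matrix.of fun s => S.piecewise (fun i => Sum.elim (x i) 0)
      (fun i => Sum.elim (0 : Fin N → K) (y i)) (c s)).det = 0 := by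
  rw [det_apply]
  refine sum_eq_zero fun π _ => ?_
  obtain ⟨t, ht⟩ : ∃ t, ¬(c (π t) ∈ S ↔ t.isLeft) := by
    by_contra! h
    refine hS ?_
    have e : (univ.map (Function.Embedding.inl : Fin N ↪ Fin N ⊕ Fin r)).map
        (π.trans c).toEmbedding = S := by
      ext i
      obtain ⟨t, rfl⟩ := (π.trans c).surjective i
      have := h t
      rcases t with t | t <;> simp_all
    rw [← e]; simp
  rw [prod_eq_zero (mem_univ t), smul_zero]
  rcases t with t | t <;> simp_all [Finset.piecewise]

/-- Laplace expansion of a determinant along its first `N` columns. -/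
theorem det_eq_sum_epsSign {N r n : ℕ} (hn : N + r = n) (x : Fin n → Fin N → K)
    (y : Fin n → Fin r → K) :
    (Matrix.of fun s : Fin N ⊕ Fin r => Sum.elim (x (finCongr hn (finSumFinEquiv s)))
      (y (finCongr hn (finSumFinEquiv s)))).det =
    ∑ S : Finset (Fin n), if h : #S = N then
      epsSign S Sᶜ • ((Matrix.of fun i => x (S.orderEmbOfFin h i)).det *
        (Matrix.of fun i => y (Sᶜ.orderEmbOfFin (k := r)
          (by rw [card_compl, Fintype.card_fin, h]; omega) i)).det)
      else 0 := by
  set c := finSumFinEquiv.trans (finCongr hn) with hc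
  let f : (Fin N ⊕ Fin r → K) [⋀^Fin n]→ₗ[K] K := detRowAlternating.domDomCongr c
  have hf (v) : f v = (Matrix.of fun s => v (c s)).det := rfl
  let X (i : Fin n) : Fin N ⊕ Fin r → K := Sum.elim (x i) 0
  let Y (i : Fin n) : Fin N ⊕ Fin r → K := Sum.elim 0 (y i)
  have hadd : f (X + Y) = ∑ S : Finset (Fin n), f (S.piecewise X Y) :=
    f.toMultilinearMap.map_add_univ X Y
  have hXY : f (X + Y) = (Matrix.of fun s : Fin N ⊕ Fin r =>
      Sum.elim (x (finCongr hn (finSumFinEquiv s))) (y (finCongr hn (finSumFinEquiv s)))).det := by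
    rw [hf]
    congr 1
    ext s t
    rcases t with t | t <;> simp [X, Y, hc]
  rw [← hXY, hadd]
  refine sum_congr rfl fun S _ => ?_
  split_ifs with h
  · have h' : #Sᶜ = r := by rw [card_compl, Fintype.card_fin, h]; omega
    have hs := f.map_perm (S.piecewise X Y) (shufflePerm hn S h h')
    have hs' : f (S.piecewise X Y) = Equiv.Perm.sign (shufflePerm hn S h h') •
        f (S.piecewise X Y ∘ shufflePerm hn S h h') := by
      rw [hs, smul_smul, Int.units_mul_self, one_smul]
    rw [hs', ← sign_shufflePerm hn S h h', hf, Units.smul_def]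
    congr 1
    rw [← det_fromBlocks_zero₂₁ _ 0 _]
    congr 1
    have hin (t : Fin N) : S.orderEmbOfFin h t ∈ S := orderEmbOfFin_mem _ _ _
    have hout (t : Fin r) : Sᶜ.orderEmbOfFin h' t ∉ S :=
      mem_compl.1 (orderEmbOfFin_mem _ _ _)
    ext s t
    rcases s with s | s <;> rcases t with t | t <;>
      simp [shufflePerm, hc, Finset.piecewise, hin, hout, X, Y]
  · exact det_piecewise_eq_zero c S h x y

theorem det_shear {N r n : ℕ} (c : Fin N ⊕ Fin r → Fin n) (x : Fin n → Fin N → K)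
    (y : Fin n → Fin r → K) (P : Matrix (Fin N) (Fin r) K) :
    (Matrix.of fun s => Sum.elim (x (c s)) (y (c s) + x (c s) ᵥ* P)).det =
      (Matrix.of fun s => Sum.elim (x (c s)) (y (c s))).det := by
  have : (Matrix.of fun s => Sum.elim (x (c s)) (y (c s) + x (c s) ᵥ* P)) =
      (Matrix.of fun s => Sum.elim (x (c s)) (y (c s))) * fromBlocks 1 P 0 1 := by
    ext s t
    rcases t with t | t
    · simp [Matrix.mul_apply, Matrix.one_apply]
    · simp [Matrix.mul_apply, Matrix.one_apply, Matrix.vecMul, dotProduct, add_comm]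
  rw [this, det_mul, det_fromBlocks_zero₂₁, det_one, det_one, one_mul, mul_one]

/-- The union of a set of indices of `Fin p` and a set of indices of `Fin q` in `Fin (p + q)`. -/
def finsetAppend {p q : ℕ} (H : Finset (Fin p)) (I : Finset (Fin q)) : Finset (Fin (p + q)) :=
  (H.disjSum I).map finSumFinEquiv.toEmbedding

section finsetAppend

variable {p q : ℕ}

@[simp]
theorem castAdd_mem_finsetAppend {H : Finset (Fin p)} {I : Finset (Fin q)} {i : Fin p} :
    Fin.castAdd q i ∈ finsetAppend H I ↔ i ∈ H := by
  rw [← finSumFinEquiv_apply_left, finsetAppend]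
  simp [-finSumFinEquiv_apply_left]

@[simp]
theorem natAdd_mem_finsetAppend {H : Finset (Fin p)} {I : Finset (Fin q)} {j : Fin q} :
    Fin.natAdd p j ∈ finsetAppend H I ↔ j ∈ I := by
  rw [← finSumFinEquiv_apply_right, finsetAppend]
  simp [-finSumFinEquiv_apply_right]

theorem card_finsetAppend (H : Finset (Fin p)) (I : Finset (Fin q)) :
    #(finsetAppend H I) = #H + #I := by
  simp [finsetAppend]

theorem compl_finsetAppend (H : Finset (Fin p)) (I : Finset (Fin q)) :
    (finsetAppend H I)ᶜ = finsetAppend Hᶜ Iᶜ := by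
  ext i
  refine Fin.addCases (fun i => ?_) (fun i => ?_) i <;> simp

theorem finsetAppend_inj {H H' : Finset (Fin p)} {I I' : Finset (Fin q)}
    (h : finsetAppend H I = finsetAppend H' I') : H = H' ∧ I = I' := by
  constructor
  · ext i
    rw [← castAdd_mem_finsetAppend (I := I), h, castAdd_mem_finsetAppend]
  · ext i
    rw [← natAdd_mem_finsetAppend (H := H), h, natAdd_mem_finsetAppend]

theorem exists_eq_finsetAppend (S : Finset (Fin (p + q))) :
    ∃ (H : Finset (Fin p)) (I : Finset (Fin q)), S = finsetAppend H I := by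
  refine ⟨({i | Fin.castAdd q i ∈ S} : Finset _), ({i | Fin.natAdd p i ∈ S} : Finset _), ?_⟩
  ext i
  refine Fin.addCases (fun i => ?_) (fun i => ?_) i <;> simp

theorem orderEmbOfFin_finsetAppend {H : Finset (Fin p)} {I : Finset (Fin q)} {k l m : ℕ}
    (hH : #H = k) (hI : #I = l) (hm : m = k + l) (h : #(finsetAppend H I) = m) (i : Fin m) :
    (finsetAppend H I).orderEmbOfFin h i =
      Fin.append (fun i => Fin.castAdd q (H.orderEmbOfFin hH i))
        (fun j => Fin.natAdd p (I.orderEmbOfFin hI j)) (Fin.cast hm i) := by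
  subst hm
  refine (congrFun (orderEmbOfFin_unique h (f := Fin.append
    (fun i => Fin.castAdd q (H.orderEmbOfFin hH i))
    (fun j => Fin.natAdd p (I.orderEmbOfFin hI j))) (fun i => ?_) ?_) i).symm
  · refine Fin.addCases (fun i => ?_) (fun i => ?_) i <;> simp
  · intro i j
    refine Fin.addCases (fun i => ?_) (fun i => ?_) i <;>
      refine Fin.addCases (fun j => ?_) (fun j => ?_) j
    · simp [castAdd_lt_castAdd]
    · simp [castAdd_lt_natAdd]
    · exact fun h => absurd h (castAdd_lt_natAdd _ _).not_gt
    · simp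

theorem append_orderEmbOfFin_finsetAppend {α : Type*} (a : Fin p → α) (b : Fin q → α)
    {H : Finset (Fin p)} {I : Finset (Fin q)} {k l m : ℕ}
    (hH : #H = k) (hI : #I = l) (hm : m = k + l) (h : #(finsetAppend H I) = m) (i : Fin m) :
    Fin.append a b ((finsetAppend H I).orderEmbOfFin h i) =
      Fin.append (fun i => a (H.orderEmbOfFin hH i)) (fun j => b (I.orderEmbOfFin hI j))
        (Fin.cast hm i) := by
  rw [orderEmbOfFin_finsetAppend hH hI hm]
  generalize Fin.cast hm i = j
  refine Fin.addCases (fun j => ?_) (fun j => ?_) j <;> simp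

theorem epsSign_finsetAppend (H H' : Finset (Fin p)) (I I' : Finset (Fin q)) :
    epsSign (finsetAppend H I) (finsetAppend H' I') =
      epsSign H H' * epsSign I I' * (-1) ^ (#I * #H') := by
  simp only [epsSign, ← prod_const, prod_filter, prod_product, finsetAppend, prod_map,
    prod_disjSum, ← card_product]
  simp [castAdd_lt_castAdd, castAdd_lt_natAdd, prod_mul_distrib, (castAdd_lt_natAdd _ _).not_gt]
  ring

end finsetAppend

theorem det_append_expand_left {N p q k r : ℕ} (hk : k + q = N) (hp : k + r = p)
    (hn : N + r = p + q) (x : Fin p → Fin N → K) (x' : Fin q → Fin N → K)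
    (y : Fin p → Fin r → K) :
    (Matrix.of fun s : Fin N ⊕ Fin r =>
      Sum.elim (Fin.append x x' (finCongr hn (finSumFinEquiv s)))
        (Fin.append y 0 (finCongr hn (finSumFinEquiv s)))).det =
    (-1) ^ (q * r) * ∑ H : Finset (Fin p), if h : #H = k then
      epsSign H Hᶜ •
        ((Matrix.of fun i => Fin.append (fun i => x (H.orderEmbOfFin h i)) x'
          (Fin.cast hk.symm i)).det *
        (Matrix.of fun i => y (Hᶜ.orderEmbOfFin (k := r)
          (by rw [card_compl, Fintype.card_fin, h]; omega) i)).det)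
      else 0 := by
  rw [det_eq_sum_epsSign hn, mul_sum]
  symm
  refine sum_of_injOn (fun H => finsetAppend H univ)
    (fun H _ H' _ h => (finsetAppend_inj h).1) (fun _ _ => mem_coe.2 (mem_univ _)) ?_ ?_
  · intro S _ hS
    split_ifs with h
    · obtain ⟨H, I, rfl⟩ := exists_eq_finsetAppend S
      obtain ⟨j, hj⟩ : ∃ j, j ∉ I := by
        by_contra! hI
        exact hS ⟨H, by simp, by rw [eq_univ_iff_forall.2 hI]⟩
      have hS' : #(finsetAppend H I)ᶜ = r := by rw [card_compl, Fintype.card_fin, h]; omega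
      obtain ⟨t, ht⟩ : Fin.natAdd p j ∈ Set.range ((finsetAppend H I)ᶜ.orderEmbOfFin hS') := by
        simp [hj]
      rw [det_eq_zero_of_row_eq_zero (A := Matrix.of fun i =>
        Fin.append y 0 ((finsetAppend H I)ᶜ.orderEmbOfFin hS' i)) t, mul_zero, smul_zero]
      intro s
      simp [ht]
    · rfl
  · intro H _
    have hc : #(finsetAppend H (univ : Finset (Fin q))) = N ↔ #H = k := by
      rw [card_finsetAppend, card_univ, Fintype.card_fin]; omega
    by_cases h : #H = k
    · have hH : #Hᶜ = r := by rw [card_compl, Fintype.card_fin, h]; omega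
      rw [dif_pos h, dif_pos (hc.2 h)]
      simp only [compl_finsetAppend]
      rw [epsSign_finsetAppend, card_fin, show q * #Hᶜ = q * r by rw [hH]]
      simp only [append_orderEmbOfFin_finsetAppend _ _ h (card_fin q) hk.symm]
      simp only [append_orderEmbOfFin_finsetAppend _ _ hH
        (show #(univ : Finset (Fin q))ᶜ = 0 by simp) (show r = r + 0 from rfl)]
      have h1 : epsSign (univ : Finset (Fin q)) univᶜ = 1 := by simp [epsSign]
      have h2 (j : Fin q) : (univ : Finset (Fin q)).orderEmbOfFin (card_fin q) j = j := by
        rw [← orderEmbOfFin_unique (card_fin q) (f := id) (fun _ => mem_univ _) strictMono_id]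
        rfl
      have h3 (i : Fin r) : Fin.append (fun i => y (Hᶜ.orderEmbOfFin hH i))
          (fun j => (0 : Fin q → Fin r → K)
            ((univ : Finset (Fin q))ᶜ.orderEmbOfFin (show _ = 0 by simp) j)) (Fin.cast rfl i) =
          y (Hᶜ.orderEmbOfFin hH i) :=
        Fin.append_left _ _ i
      simp only [h1, h2, h3, zsmul_eq_mul]
      push_cast
      ring
    · rw [dif_neg h, dif_neg (mt hc.1 h), mul_zero]

theorem det_append_expand_right {N p q l r : ℕ} (hl : p + l = N) (hq : r + l = q)
    (hn : N + r = p + q) (x : Fin p → Fin N → K) (x' : Fin q → Fin N → K)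
    (y : Fin q → Fin r → K) :
    (Matrix.of fun s : Fin N ⊕ Fin r =>
      Sum.elim (Fin.append x x' (finCongr hn (finSumFinEquiv s)))
        (Fin.append 0 (-y) (finCongr hn (finSumFinEquiv s)))).det =
    (-1) ^ (q * r) * ∑ I : Finset (Fin q), if h : #I = r then
      epsSign I Iᶜ •
        ((Matrix.of fun i => Fin.append x (fun i => x' (Iᶜ.orderEmbOfFin (k := l)
          (by rw [card_compl, Fintype.card_fin, h]; omega) i))
          (Fin.cast hl.symm i)).det *
        (Matrix.of fun i => y (I.orderEmbOfFin h i)).det)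
      else 0 := by
  rw [det_eq_sum_epsSign hn, mul_sum]
  symm
  refine sum_of_injOn (fun I => finsetAppend univ Iᶜ)
    (fun I _ I' _ h => compl_injective (finsetAppend_inj h).2)
    (fun _ _ => mem_coe.2 (mem_univ _)) ?_ ?_
  · intro S _ hS
    split_ifs with h
    · obtain ⟨H, I, rfl⟩ := exists_eq_finsetAppend S
      obtain ⟨j, hj⟩ : ∃ j, j ∉ H := by
        by_contra! hH
        exact hS ⟨Iᶜ, by simp, by simp [eq_univ_iff_forall.2 hH]⟩
      have hS' : #(finsetAppend H I)ᶜ = r := by rw [card_compl, Fintype.card_fin, h]; omega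
      obtain ⟨t, ht⟩ : Fin.castAdd q j ∈ Set.range ((finsetAppend H I)ᶜ.orderEmbOfFin hS') := by
        simp [hj]
      rw [det_eq_zero_of_row_eq_zero (A := Matrix.of fun i =>
        Fin.append 0 (-y) ((finsetAppend H I)ᶜ.orderEmbOfFin hS' i)) t, mul_zero, smul_zero]
      intro s
      simp [ht]
    · rfl
  · intro I _
    have hI' : #Iᶜ = q - #I := by rw [card_compl, Fintype.card_fin]
    have hle : #I ≤ q := by simpa using card_le_univ I
    have hc : #(finsetAppend (univ : Finset (Fin p)) Iᶜ) = N ↔ #I = r := by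
      rw [card_finsetAppend, card_univ, Fintype.card_fin]; omega
    by_cases h : #I = r
    · have hI : #Iᶜ = l := by omega
      rw [dif_pos h, dif_pos (hc.2 h)]
      simp only [compl_finsetAppend, compl_compl]
      rw [epsSign_finsetAppend]
      simp only [append_orderEmbOfFin_finsetAppend _ _ (card_fin p) hI hl.symm]
      simp only [append_orderEmbOfFin_finsetAppend _ _
        (show #(univ : Finset (Fin p))ᶜ = 0 by simp) h (show r = 0 + r by simp)]
      have h1 : epsSign (univ : Finset (Fin p)) univᶜ = 1 := by simp [epsSign]
      have h2 (j : Fin p) : (univ : Finset (Fin p)).orderEmbOfFin (card_fin p) j = j := by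
        rw [← orderEmbOfFin_unique (card_fin p) (f := id) (fun _ => mem_univ _) strictMono_id]
        rfl
      have h3 (i : Fin r) : Fin.append
          (fun j => (0 : Fin p → Fin r → K)
            ((univ : Finset (Fin p))ᶜ.orderEmbOfFin (show _ = 0 by simp) j))
          (fun i => (-y) (I.orderEmbOfFin h i)) (Fin.cast (show r = 0 + r by simp) i) =
          - y (I.orderEmbOfFin h i) := by
        have : Fin.cast (show r = 0 + r by simp) i = Fin.natAdd 0 i := by ext; simp
        rw [this, Fin.append_right]
        rfl
      have h4 : (Matrix.of fun i => -y (I.orderEmbOfFin h i)).det =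
          (-1) ^ r * (Matrix.of fun i => y (I.orderEmbOfFin h i)).det := by
        have := det_neg (Matrix.of fun i => y (I.orderEmbOfFin h i))
        rwa [Fintype.card_fin] at this
      have h5 : epsSign Iᶜ I = (-1) ^ (l * r) * epsSign I Iᶜ := by
        have e : #{x ∈ Iᶜ ×ˢ I | ¬ x.2 < x.1} = #{x ∈ I ×ˢ Iᶜ | x.2 < x.1} := by
          refine card_equiv (Equiv.prodComm _ _) fun x => ?_
          simp only [mem_filter, mem_product, mem_compl, Equiv.prodComm_apply, Prod.fst_swap,
            Prod.snd_swap, not_lt]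
          refine ⟨fun ⟨⟨h1, h2⟩, h3⟩ => ⟨⟨h2, h1⟩, lt_of_le_of_ne h3 ?_⟩,
            fun ⟨⟨h1, h2⟩, h3⟩ => ⟨⟨h2, h1⟩, h3.le⟩⟩
          rintro h
          exact h1 (h ▸ h2)
        have e' := card_filter_add_card_filter_not (s := Iᶜ ×ˢ I) (fun x => x.2 < x.1)
        rw [card_product, hI, h] at e'
        rw [epsSign, epsSign, ← e, ← e', pow_add, mul_assoc, ← pow_add, ← two_mul, pow_mul _ 2]
        simp
      simp only [h1, h2, h3, h4, h5, hI, card_compl, card_fin, zsmul_eq_mul]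
      have h6 : ((-1 : K) ^ (q * r)) = (-1) ^ (l * r) * (-1) ^ r := by
        rw [← hq, add_mul, pow_add, mul_comm]
        congr 1
        rcases Nat.even_or_odd r with hr | hr
        · rw [hr.neg_one_pow, (hr.mul_left r).neg_one_pow]
        · rw [hr.neg_one_pow, (hr.mul hr).neg_one_pow]
      rw [h6]
      push_cast
      simp
      ring
    · rw [dif_neg h, dif_neg (mt hc.1 h), mul_zero]

theorem sum_det_append_mul_det_eq {N p q k l r : ℕ} (hk : k + q = N) (hl : p + l = N)
    (hp : k + r = p) (hq : r + l = q) (x : Fin p → Fin N → K) (x' : Fin q → Fin N → K)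
    (P : Matrix (Fin N) (Fin r) K) :
    (∑ H : Finset (Fin p), if h : #H = k then
      epsSign H Hᶜ •
        ((Matrix.of fun i => Fin.append (fun i => x (H.orderEmbOfFin h i)) x'
          (Fin.cast hk.symm i)).det *
        (Matrix.of fun i => x (Hᶜ.orderEmbOfFin (k := r)
          (by rw [card_compl, Fintype.card_fin, h]; omega) i) ᵥ* P).det)
      else 0) =
    ∑ I : Finset (Fin q), if h : #I = r then
      epsSign I Iᶜ •
        ((Matrix.of fun i => Fin.append x (fun i => x' (Iᶜ.orderEmbOfFin (k := l)
          (by rw [card_compl, Fintype.card_fin, h]; omega) i))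
          (Fin.cast hl.symm i)).det *
        (Matrix.of fun i => x' (I.orderEmbOfFin h i) ᵥ* P).det)
      else 0 := by
  have hn : N + r = p + q := by omega
  refine mul_left_cancel₀ (pow_ne_zero (q * r) (neg_ne_zero.2 (one_ne_zero (α := K)))) ?_
  rw [← det_append_expand_left hk hp hn x x' fun i => x i ᵥ* P,
    ← det_append_expand_right hl hq hn x x' fun i => x' i ᵥ* P,
    ← det_shear (fun s => finCongr hn (finSumFinEquiv s)) (Fin.append x x')
      (Fin.append 0 (-fun i => x' i ᵥ* P)) P]
  congr! 5 with s
  generalize finCongr hn (finSumFinEquiv s) = i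
  refine Fin.addCases (fun i => ?_) (fun i => ?_) i <;> simp

theorem AlternatingMap.apply_eq_mul_det {N : ℕ} {W : Type*} [AddCommGroup W] [Module K W]
    (e : Module.Basis (Fin N) K W) (ω : W [⋀^Fin N]→ₗ[K] K) (v : Fin N → W) :
    ω v = ω e * (Matrix.of fun i => (e.repr (v i) : Fin N → K)).det := by
  conv_lhs => rw [ω.eq_smul_basis_det e]
  rw [AlternatingMap.smul_apply, smul_eq_mul, Module.Basis.det_apply, ← det_transpose]
  rfl

theorem ιMultiDual_apply_eq_det {N r : ℕ} {W : Type*} [AddCommGroup W] [Module K W]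
    (e : Module.Basis (Fin N) K W) (s : Set.powersetCard (Fin N) r) (v : Fin r → W) :
    exteriorPower.ιMultiDual K r e s (exteriorPower.ιMulti K r v) =
      (Matrix.of fun i => (e.repr (v i) : Fin N → K) ᵥ* Matrix.of fun m j =>
        if m = Set.powersetCard.ofFinEmbEquiv.symm s j then (1 : K) else 0).det := by
  rw [exteriorPower.ιMultiDual_apply_ιMulti]
  congr 1
  ext i j
  simp [Matrix.vecMul, dotProduct]

theorem sum_smul_ιMulti_eq {N p q k l r : ℕ} {W : Type*} [AddCommGroup W] [Module K W]
    (e : Module.Basis (Fin N) K W) (hk : k + q = N) (hl : p + l = N)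
    (hp : k + r = p) (hq : r + l = q) (a : Fin p → W) (b : Fin q → W) (ω : W [⋀^Fin N]→ₗ[K] K) :
    (∑ H : Finset (Fin p), if h : #H = k then
      epsSign H Hᶜ •
        (ω (fun i => Fin.append (fun i => a (H.orderEmbOfFin h i)) b (Fin.cast hk.symm i)) •
        exteriorPower.ιMulti K r (fun i => a (Hᶜ.orderEmbOfFin (k := r)
          (by rw [card_compl, Fintype.card_fin, h]; omega) i)))
      else 0) =
    ∑ I : Finset (Fin q), if h : #I = r then
      epsSign I Iᶜ •
        (ω (fun i => Fin.append a (fun i => b (Iᶜ.orderEmbOfFin (k := l)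
          (by rw [card_compl, Fintype.card_fin, h]; omega) i)) (Fin.cast hl.symm i)) •
        exteriorPower.ιMulti K r (fun i => b (I.orderEmbOfFin h i)))
      else 0 := by
  refine (e.exteriorPower r).ext_elem fun s => ?_
  rw [exteriorPower.basis_repr_apply, exteriorPower.basis_repr_apply, map_sum, map_sum]
  have key := congrArg (ω e * ·) (sum_det_append_mul_det_eq hk hl hp hq
    (fun i => (e.repr (a i) : Fin N → K)) (fun i => (e.repr (b i) : Fin N → K))
    (Matrix.of fun m j => if m = Set.powersetCard.ofFinEmbEquiv.symm s j then (1 : K) else 0))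
  simp only [mul_sum] at key
  have happ {m n : ℕ} (u : Fin m → W) (v : Fin n → W) (i : Fin (m + n)) :
      (e.repr (Fin.append u v i) : Fin N → K) =
        Fin.append (fun i => (e.repr (u i) : Fin N → K)) (fun i => (e.repr (v i) : Fin N → K)) i := by
    refine Fin.addCases (fun i => ?_) (fun i => ?_) i <;> simp
  convert key using 2 with H _ I _
  · split_ifs with h
    · rw [map_zsmul, map_smul, ιMultiDual_apply_eq_det, ω.apply_eq_mul_det e]
      simp only [happ, smul_eq_mul, zsmul_eq_mul]
      ring
    · simp
  · split_ifs with h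
    · rw [map_zsmul, map_smul, ιMultiDual_apply_eq_det, ω.apply_eq_mul_det e]
      simp only [happ, smul_eq_mul, zsmul_eq_mul]
      ring
    · simp

end

/-- The Grassmann–Cayley "meet" identity: for vectors `a_1, …, a_p` and `b_1, …, b_q` of an
`N`-dimensional vector space `W` with `p + q > N` and any alternating `N`-multilinear form `ω`,
`Σ_{H∪C={1..p}} ε_{H|C} ω(a_H, b) a_C = Σ_{I∪J={1..q}} ε_{I|J} ω(a, b_J) b_I`
in the `(p+q−N)`-th exterior power of `W`. -/
theorem stmt_0 {K W : Type*} [Field K] [AddCommGroup W] [Module K W]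
    (N p q : ℕ) (hW : Module.finrank K W = N)
    (hp : p ≤ N) (hq : q ≤ N) (hpq : N < p + q)
    (a : Fin p → W) (b : Fin q → W)
    (ω : W [⋀^Fin N]→ₗ[K] K) :
    ∑ H : Finset (Fin p),
        (if h : H.card = N - q then
          epsSign H Hᶜ •
            (ω (fun j => Fin.addCases (motive := fun _ => W)
                  (fun i => a ((H.orderIsoOfFin h i : Fin p)))
                  b (Fin.cast (by omega) j)) •
              ExteriorAlgebra.ιMulti K (p + q - N)
                (fun i => a ((Hᶜ.orderIsoOfFin (k := p + q - N)
                  (by rw [Finset.card_compl, Fintype.card_fin, h]; omega) i : Fin p))))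
        else 0)
      =
      ∑ I : Finset (Fin q),
        (if h : I.card = p + q - N then
          epsSign I Iᶜ •
            (ω (fun j => Fin.addCases (motive := fun _ => W)
                  a
                  (fun i => b ((Iᶜ.orderIsoOfFin (k := N - p)
                    (by rw [Finset.card_compl, Fintype.card_fin, h]; omega) i : Fin q)))
                  (Fin.cast (by omega) j)) •
              ExteriorAlgebra.ιMulti K (p + q - N)
                (fun i => b ((I.orderIsoOfFin h i : Fin q))))
        else 0) := by
  have : Module.Finite K W := Module.finite_of_finrank_pos (by omega)
  have key := congrArg (Subtype.val : ⋀[K]^(p + q - N) W → ExteriorAlgebra K W)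
    (sum_smul_ιMulti_eq (Module.finBasisOfFinrankEq K W hW) (k := N - q) (l := N - p)
      (r := p + q - N) (by omega) (by omega) (by omega) (by omega) a b ω)
  rw [AddSubmonoidClass.coe_finsetSum, AddSubmonoidClass.coe_finsetSum] at key
  convert key using 2 with H _ I _
  · split_ifs with h <;> rfl
  · split_ifs with h <;> rfl
end

section
/- Let k be a field, S = k[x_0, …, x_n], and let B be a Borel-fixed set of monomials of degree r, i.e. for every monomial u ∈ B and all indices 0 ≤ i < j ≤ n with x_i dividing u, the monomial (x_j/x_i)·u also belongs to B. Let W ⊆ S_r denote the k-linear span of B, and fix 0 ≤ d ≤ n. Then (Σ_{i=0}^n x_i·W) ∩ (x_0, …, x_d)_{r+1} = Σ_{i=0}^d x_i·W, where (x_0, …, x_d)_{r+1} denotes the k-linear span of the degree-(r+1) monomials divisible by at least one of the variables x_0, …, x_d. -/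
open MvPolynomial

/-- The span of the monomials with exponents in `s ∩ t` is the intersection of the spans for `s`
and for `t`. -/
theorem MvPolynomial.span_monomial_inter {σ R : Type*} [CommSemiring R] (s t : Set (σ →₀ ℕ)) :
    Submodule.span R ((fun m => (monomial m (1 : R) : MvPolynomial σ R)) '' (s ∩ t)) =
      Submodule.span R ((fun m => (monomial m (1 : R) : MvPolynomial σ R)) '' s) ⊓
        Submodule.span R ((fun m => (monomial m (1 : R) : MvPolynomial σ R)) '' t) := by
  simp_rw [← restrictSupport_eq_span]
  ext p
  simp [mem_restrictSupport_iff]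

/-- Multiplication by `X i` shifts the exponents of a span of monomials by `single i 1`. -/
theorem MvPolynomial.map_mulLeft_X_span_monomial {σ R : Type*} [CommSemiring R] (i : σ)
    (s : Set (σ →₀ ℕ)) :
    (Submodule.span R ((fun m => (monomial m (1 : R) : MvPolynomial σ R)) '' s)).map
        (LinearMap.mulLeft R (X i)) =
      Submodule.span R ((fun m => (monomial m (1 : R) : MvPolynomial σ R)) ''
        ((fun m => Finsupp.single i 1 + m) '' s)) := by
  rw [Submodule.map_span, Set.image_image, Set.image_image]
  simp [X, monomial_mul]

/-- Let `B` be a Borel-fixed set of monomials of degree `r` in `k[x_0, …, x_n]`, `W` its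
`k`-linear span, and `0 ≤ d ≤ n`.  Then
`(Σ_{i=0}^n x_i·W) ∩ (x_0, …, x_d)_{r+1} = Σ_{i=0}^d x_i·W`. -/
theorem stmt_9 {k : Type*} [Field k] (n r d : ℕ) (hd : d ≤ n)
    (B : Finset (Fin (n + 1) →₀ ℕ))
    (hdeg : ∀ m ∈ B, m.degree = r)
    (hBorel : ∀ u ∈ B, ∀ i j : Fin (n + 1), i < j → u i ≠ 0 →
      u + Finsupp.single j 1 - Finsupp.single i 1 ∈ B) :
    (⨆ i : Fin (n + 1),
        (Submodule.span k
          ((fun m => (monomial m (1 : k) : MvPolynomial (Fin (n + 1)) k)) '' ↑B)).map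
          (LinearMap.mulLeft k (X i)))
      ⊓ Submodule.span k {x : MvPolynomial (Fin (n + 1)) k |
          ∃ m : Fin (n + 1) →₀ ℕ, m.degree = r + 1 ∧
            (∃ i : Fin (n + 1), (i : ℕ) ≤ d ∧ m i ≠ 0) ∧ x = monomial m 1}
      = ⨆ i ∈ Finset.filter (fun i : Fin (n + 1) => (i : ℕ) ≤ d) Finset.univ,
          (Submodule.span k
            ((fun m => (monomial m (1 : k) : MvPolynomial (Fin (n + 1)) k)) '' ↑B)).map
            (LinearMap.mulLeft k (X i)) := by
  have hset : {x : MvPolynomial (Fin (n + 1)) k |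
      ∃ m : Fin (n + 1) →₀ ℕ, m.degree = r + 1 ∧
        (∃ i : Fin (n + 1), (i : ℕ) ≤ d ∧ m i ≠ 0) ∧ x = monomial m 1} =
      (fun m => (monomial m (1 : k) : MvPolynomial (Fin (n + 1)) k)) ''
        {m | m.degree = r + 1 ∧ ∃ i : Fin (n + 1), (i : ℕ) ≤ d ∧ m i ≠ 0} := by
    ext x
    simp only [Set.mem_ofPred_eq, Set.mem_image, and_assoc, eq_comm (a := x)]
  simp_rw [hset, map_mulLeft_X_span_monomial, ← Submodule.span_iUnion, ← Set.image_iUnion,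
    ← span_monomial_inter]
  congr 2
  ext m
  simp only [Set.mem_inter_iff, Set.mem_iUnion, Set.mem_image, Set.mem_ofPred_eq, Finset.mem_coe,
    Finset.mem_filter, Finset.mem_univ, true_and, exists_prop]
  constructor
  · rintro ⟨⟨i, u, hu, rfl⟩, -, j, hj, hmj⟩
    by_cases hi : (i : ℕ) ≤ d
    · exact ⟨i, u, ⟨hi, hu⟩, rfl⟩
    have hji : j < i := Fin.lt_def.mpr (by omega)
    have huj : u j ≠ 0 := by simpa [Finsupp.single_eq_of_ne hji.ne] using hmj
    refine ⟨j, _, ⟨hj, hBorel u hu j i hji huj⟩, ?_⟩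
    have hle : Finsupp.single j 1 ≤ u + Finsupp.single i 1 :=
      (Finsupp.single_le_iff.mpr (Nat.one_le_iff_ne_zero.mpr huj)).trans le_self_add
    rw [add_tsub_cancel_of_le hle, add_comm u]
  · rintro ⟨i, u, ⟨hi, hu⟩, rfl⟩
    exact ⟨⟨i, u, hu, rfl⟩, by simp [hdeg u hu, add_comm], i, hi, by simp⟩
end

section
/- Let k be a field, S = k[x_0, …, x_n], and let B be a Borel-fixed set of monomials of degree r, i.e. for every monomial u ∈ B and all indices 0 ≤ i < j ≤ n with x_i dividing u, the monomial (x_j/x_i)·u also belongs to B. Let W ⊆ S_r denote the k-linear span of B, let 0 ≤ d < n, and assume moreover that every degree-r monomial in the variables x_{d+1}, …, x_n alone belongs to B. Then dim_k(Σ_{i=0}^d x_i·W) = dim_k(Σ_{i=0}^n x_i·W) − C(n−d+r, n−d−1), where C(n−d+r, n−d−1) is the number of degree-(r+1) monomials in the variables x_{d+1}, …, x_n. -/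
open MvPolynomial

section MonomialSpan

variable {σ : Type*}

/-- The set of monomials `x_i u` with `i ∈ I` and `u ∈ B`, as exponent vectors. -/
noncomputable def shiftedMonomials [DecidableEq σ] (I : Finset σ) (B : Finset (σ →₀ ℕ)) :
    Finset (σ →₀ ℕ) :=
  I.biUnion fun i => B.image (Finsupp.single i 1 + ·)

theorem mem_shiftedMonomials [DecidableEq σ] {I : Finset σ} {B : Finset (σ →₀ ℕ)} {m : σ →₀ ℕ} :
    m ∈ shiftedMonomials I B ↔ ∃ i ∈ I, ∃ u ∈ B, Finsupp.single i 1 + u = m := by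
  simp [shiftedMonomials]

theorem finrank_span_monomial_image (k : Type*) [Field k] (A : Finset (σ →₀ ℕ)) :
    Module.finrank k (Submodule.span k
      ((fun m => (monomial m (1 : k) : MvPolynomial σ k)) '' (A : Set (σ →₀ ℕ)))) = A.card := by
  have hli : LinearIndependent k (fun m : σ →₀ ℕ => (monomial m (1 : k) : MvPolynomial σ k)) := by
    simpa using (basisMonomials σ k).linearIndependent
  have h := finrank_span_eq_card (hli.comp (Subtype.val : A → σ →₀ ℕ) Subtype.val_injective)
  rwa [Set.range_comp, Subtype.range_coe_subtype, Finset.setOfPred_mem, Fintype.card_coe] at h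

theorem iSup_map_mulLeft_X_span_monomial [DecidableEq σ] (k : Type*) [Field k]
    (I : Finset σ) (B : Finset (σ →₀ ℕ)) :
    (⨆ i ∈ I, (Submodule.span k
        ((fun m => (monomial m (1 : k) : MvPolynomial σ k)) '' (B : Set (σ →₀ ℕ)))).map
        (LinearMap.mulLeft k (X i))) =
      Submodule.span k ((fun m => (monomial m (1 : k) : MvPolynomial σ k)) ''
        (shiftedMonomials I B : Set (σ →₀ ℕ))) := by
  simp only [Submodule.map_span, ← Submodule.span_iUnion, shiftedMonomials, Finset.coe_biUnion,
    Finset.coe_image, Set.image_iUnion, Set.image_image, LinearMap.mulLeft_apply, X,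
    monomial_mul, one_mul, Finset.mem_coe]

theorem finrank_iSup_map_mulLeft_X [DecidableEq σ] (k : Type*) [Field k] (I : Finset σ)
    (B : Finset (σ →₀ ℕ)) :
    Module.finrank k ↥(⨆ i ∈ I, (Submodule.span k
        ((fun m => (monomial m (1 : k) : MvPolynomial σ k)) '' (B : Set (σ →₀ ℕ)))).map
        (LinearMap.mulLeft k (X i))) = (shiftedMonomials I B).card := by
  rw [iSup_map_mulLeft_X_span_monomial, finrank_span_monomial_image]

end MonomialSpan

theorem mem_finsuppAntidiag_Ioi_iff {n d r : ℕ} {m : Fin (n + 1) →₀ ℕ} :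
    m ∈ (Finset.univ.filter fun i : Fin (n + 1) => d < i).finsuppAntidiag r ↔
      m.degree = r ∧ ∀ i : Fin (n + 1), (i : ℕ) ≤ d → m i = 0 := by
  rw [Finset.mem_finsuppAntidiag']
  refine and_congr Iff.rfl ⟨fun h i hi => ?_, fun h i hi => ?_⟩
  · by_contra hne
    have := h (Finsupp.mem_support_iff.mpr hne)
    simp only [Finset.mem_filter, Finset.mem_univ, true_and] at this
    omega
  · simp only [Finset.mem_filter, Finset.mem_univ, true_and]
    by_contra hle
    exact Finsupp.mem_support_iff.mp hi (h i (by omega))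

theorem card_finsuppAntidiag_Ioi {n d : ℕ} (r : ℕ) (hd : d < n) :
    ((Finset.univ.filter fun i : Fin (n + 1) => d < i).finsuppAntidiag (r + 1)).card =
      (n - d + r).choose (n - d - 1) := by
  have hcard : (Finset.univ.filter fun i : Fin (n + 1) => d < i).card = n - d := by
    have : (Finset.univ.filter fun i : Fin (n + 1) => d < i) =
        Finset.Ioi (⟨d, by omega⟩ : Fin (n + 1)) := by
      ext i
      simp [Fin.lt_def]
    rw [this, Fin.card_Ioi]
    simp
  rw [Finset.card_finsuppAntidiag_nat_eq_choose, hcard, ← Nat.choose_symm_of_eq_add]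
  · congr 1
  · omega

/-- For a Borel-fixed set of monomials, the monomials of `x_0 B ∪ ⋯ ∪ x_n B` that are not in
`x_0 B ∪ ⋯ ∪ x_d B` are exactly the monomials in `x_{d+1}, …, x_n`. -/
theorem shiftedMonomials_univ_eq_union {n r d : ℕ}
    {B : Finset (Fin (n + 1) →₀ ℕ)}
    (hdeg : ∀ m ∈ B, m.degree = r)
    (hBorel : ∀ u ∈ B, ∀ i j : Fin (n + 1), i < j → u i ≠ 0 →
      u + Finsupp.single j 1 - Finsupp.single i 1 ∈ B)
    (hfull : ∀ m : Fin (n + 1) →₀ ℕ, m.degree = r →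
      (∀ i : Fin (n + 1), (i : ℕ) ≤ d → m i = 0) → m ∈ B) :
    shiftedMonomials Finset.univ B =
      shiftedMonomials (Finset.univ.filter fun i : Fin (n + 1) => (i : ℕ) ≤ d) B ∪
        (Finset.univ.filter fun i : Fin (n + 1) => d < i).finsuppAntidiag (r + 1) := by
  ext m
  rw [Finset.mem_union, mem_finsuppAntidiag_Ioi_iff]
  simp only [mem_shiftedMonomials, Finset.mem_univ, true_and, Finset.mem_filter]
  constructor
  · rintro ⟨i, u, hu, rfl⟩
    by_cases hi : (i : ℕ) ≤ d
    · exact Or.inl ⟨i, hi, u, hu, rfl⟩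
    by_cases hz : ∀ j : Fin (n + 1), (j : ℕ) ≤ d → u j = 0
    · refine Or.inr ⟨by rw [map_add, Finsupp.degree_single, hdeg u hu, add_comm], fun j hj => ?_⟩
      have hij : i ≠ j := by rintro rfl; exact hi hj
      simp [hz j hj, hij]
    · push Not at hz
      obtain ⟨j, hj, hne⟩ := hz
      refine Or.inl ⟨j, hj, _, hBorel u hu j i (Fin.lt_def.mpr (by omega)) hne, ?_⟩
      have hle : Finsupp.single j 1 ≤ u + Finsupp.single i 1 :=
        (Finsupp.single_le_iff.mpr (Nat.one_le_iff_ne_zero.mpr hne)).trans le_self_add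
      rw [add_tsub_cancel_of_le hle, add_comm u]
  · rintro (⟨i, -, u, hu, rfl⟩ | ⟨hm, hz⟩)
    · exact ⟨i, u, hu, rfl⟩
    · obtain ⟨i, hi⟩ : ∃ i, m i ≠ 0 := by
        by_contra! h
        rw [show m = 0 from Finsupp.ext h, map_zero] at hm
        omega
      have hle : Finsupp.single i 1 ≤ m :=
        Finsupp.single_le_iff.mpr (Nat.one_le_iff_ne_zero.mpr hi)
      have hadd := add_tsub_cancel_of_le hle
      refine ⟨i, m - Finsupp.single i 1, hfull _ ?_ fun j hj => ?_, hadd⟩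
      · have := congrArg Finsupp.degree hadd
        rw [map_add, Finsupp.degree_single, hm] at this
        omega
      · simp [hz j hj]

theorem disjoint_shiftedMonomials_finsuppAntidiag {n d : ℕ} (r : ℕ)
    (B : Finset (Fin (n + 1) →₀ ℕ)) :
    Disjoint (shiftedMonomials (Finset.univ.filter fun i : Fin (n + 1) => (i : ℕ) ≤ d) B)
      ((Finset.univ.filter fun i : Fin (n + 1) => d < i).finsuppAntidiag r) := by
  refine Finset.disjoint_left.mpr fun m hm hm' => ?_
  obtain ⟨i, hi, u, -, rfl⟩ := mem_shiftedMonomials.mp hm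
  have := (mem_finsuppAntidiag_Ioi_iff.mp hm').2 i (Finset.mem_filter.mp hi).2
  simp at this

/-- Let `B` be a Borel-fixed set of monomials of degree `r` in `k[x_0, …, x_n]`, `W` its
`k`-linear span, and `0 ≤ d < n`.  Assume every degree-`r` monomial in the variables
`x_{d+1}, …, x_n` alone belongs to `B`.  Then
`dim_k(Σ_{i=0}^d x_i·W) = dim_k(Σ_{i=0}^n x_i·W) − C(n−d+r, n−d−1)`
(stated additively to avoid truncated subtraction). -/
theorem stmt_10 {k : Type*} [Field k] (n r d : ℕ) (hd : d < n)
    (B : Finset (Fin (n + 1) →₀ ℕ))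
    (hdeg : ∀ m ∈ B, m.degree = r)
    (hBorel : ∀ u ∈ B, ∀ i j : Fin (n + 1), i < j → u i ≠ 0 →
      u + Finsupp.single j 1 - Finsupp.single i 1 ∈ B)
    (hfull : ∀ m : Fin (n + 1) →₀ ℕ, m.degree = r →
      (∀ i : Fin (n + 1), (i : ℕ) ≤ d → m i = 0) → m ∈ B) :
    Module.finrank k
        ↥(⨆ i ∈ Finset.filter (fun i : Fin (n + 1) => (i : ℕ) ≤ d) Finset.univ,
          (Submodule.span k
            ((fun m => (monomial m (1 : k) : MvPolynomial (Fin (n + 1)) k)) '' ↑B)).map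
            (LinearMap.mulLeft k (X i)))
        + Nat.choose (n - d + r) (n - d - 1)
      = Module.finrank k
          ↥(⨆ i : Fin (n + 1),
            (Submodule.span k
              ((fun m => (monomial m (1 : k) : MvPolynomial (Fin (n + 1)) k)) '' ↑B)).map
              (LinearMap.mulLeft k (X i))) := by
  have huniv := iSup_map_mulLeft_X_span_monomial k Finset.univ B
  simp only [Finset.mem_univ, iSup_pos] at huniv
  rw [huniv, finrank_span_monomial_image, finrank_iSup_map_mulLeft_X,
    shiftedMonomials_univ_eq_union hdeg hBorel hfull,
    Finset.card_union_of_disjoint (disjoint_shiftedMonomials_finsuppAntidiag _ B),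
    card_finsuppAntidiag_Ioi r hd]
end

section
/- For all integers n, d, r with d ≥ 0, n ≥ d+2 and r ≥ 2, the strict inequality C(n+r, n) − C(n−d−1+r, n−d−1) > Σ_{i=1}^r C(d+i, d) holds. -/
/-- Hockey-stick identity along a diagonal starting at `i = 1`. -/
theorem sum_Icc_choose_diag_add_one (d r : ℕ) :
    (∑ i ∈ Finset.Icc 1 r, Nat.choose (d + i) d) + 1 = Nat.choose (d + 1 + r) (d + 1) := by
  induction r with
  | zero => simp
  | succ r ih =>
    rw [Finset.sum_Icc_succ_top (by omega), add_right_comm, ih, ← add_assoc (d + 1) r 1,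
      Nat.choose_succ_succ (d + 1 + r) d, show d + (r + 1) = d + 1 + r by ring, add_comm]

theorem add_two_le_choose (s : ℕ) (hs : 1 ≤ s) : s + 2 ≤ Nat.choose (s + 2) s := by
  induction s, hs using Nat.le_induction with
  | base => decide
  | succ s hs ih =>
    have h := Nat.choose_succ_succ (s + 2) s
    have h' : Nat.choose (s + 2) (s + 1) = s + 2 := Nat.choose_succ_self_right (s + 1)
    rw [show s + 1 + 2 = s + 2 + 1 by ring]
    simp only [Nat.succ_eq_add_one] at h
    omega

/-- Superadditivity of `k ↦ C(k + r, r)` on positive integers, for `r = s + 1 ≥ 2`. -/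
theorem choose_add_choose_le_choose_add (s k m : ℕ) (hs : 1 ≤ s) (hk : 1 ≤ k) (hm : 1 ≤ m) :
    Nat.choose (k + (s + 1)) (s + 1) + Nat.choose (m + (s + 1)) (s + 1)
      ≤ Nat.choose (m + k + (s + 1)) (s + 1) := by
  induction m, hm using Nat.le_induction with
  | base =>
    have h := Nat.choose_succ_succ (k + (s + 1)) s
    have h₁ : Nat.choose (1 + (s + 1)) (s + 1) = s + 2 := by
      rw [add_comm 1 (s + 1)]
      exact Nat.choose_succ_self_right (s + 1)
    have h₂ : Nat.choose (s + 2) s ≤ Nat.choose (k + (s + 1)) s :=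
      Nat.choose_le_choose s (by omega)
    have h₃ := add_two_le_choose s hs
    rw [show 1 + k + (s + 1) = k + (s + 1) + 1 by ring]
    simp only [Nat.succ_eq_add_one] at h
    omega
  | succ m hm ih =>
    have h₁ := Nat.choose_succ_succ (m + (s + 1)) s
    have h₂ := Nat.choose_succ_succ (m + k + (s + 1)) s
    have h₃ : Nat.choose (m + (s + 1)) s ≤ Nat.choose (m + k + (s + 1)) s :=
      Nat.choose_le_choose s (by omega)
    rw [show m + 1 + (s + 1) = m + (s + 1) + 1 by ring,
      show m + 1 + k + (s + 1) = m + k + (s + 1) + 1 by ring]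
    simp only [Nat.succ_eq_add_one] at h₁ h₂
    omega

/-- For all integers `n`, `d`, `r` with `d ≥ 0`, `n ≥ d+2` and `r ≥ 2`, the strict inequality
`C(n+r, n) − C(n−d−1+r, n−d−1) > Σ_{i=1}^r C(d+i, d)` holds.  (Stated additively to avoid
truncated natural-number subtraction.) -/
theorem stmt_13 (n d r : ℕ) (hn : d + 2 ≤ n) (hr : 2 ≤ r) :
    (∑ i ∈ Finset.Icc 1 r, Nat.choose (d + i) d) + Nat.choose (n - d - 1 + r) (n - d - 1)
      < Nat.choose (n + r) n := by
  have h := sum_Icc_choose_diag_add_one d r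
  obtain ⟨s, rfl⟩ : ∃ s, r = s + 1 := ⟨r - 1, by omega⟩
  have h' := choose_add_choose_le_choose_add s (d + 1) (n - d - 1)
    (by omega) (by omega) (by omega)
  rw [show n - d - 1 + (d + 1) = n by omega, ← Nat.choose_symm_add, ← Nat.choose_symm_add,
    ← Nat.choose_symm_add] at h'
  omega
end

section
/- Let K be a field of characteristic 0 and fix integers a_0 ≥ … ≥ a_s ≥ 0 with a_0 = d < n; let p(t) = Σ_{i=0}^s C(t+a_i−i, a_i), r = s+1 its Gotzmann number, q(t) = C(n+t, n) − p(t), and q'(t) = q(t) − C(n−d−1+t, n−d−1). Let V ⊆ K[x_0, …, x_n]_r be a subspace with dim_K V = q(r) such that the projection π : K[x_0, …, x_n]_r → K[x_{d+1}, …, x_n]_r obtained by setting x_0 = … = x_d = 0 maps V onto K[x_{d+1}, …, x_n]_r. Set W = x_0·V + ⋯ + x_d·V ⊆ K[x_0, …, x_n]_{r+1} and assume dim_K W ≥ q'(r+1). Then dim_K(K[x_0, …, x_n]_1 · V) = q(r+1) if and only if dim_K W = q'(r+1) and (K[x_0, …, x_n]_1 · V) ∩ (x_0, …, x_d)_{r+1}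 = W. -/
open MvPolynomial

namespace MvPolynomial

variable {σ K : Type*} [Field K]

/-- A homogeneous subspace spanned by monomials on a fixed set of variables has the expected
dimension. -/
theorem finrank_restrictSupport_degree_eq [Fintype σ] [DecidableEq σ] (s : Finset σ) (k : ℕ) :
    Module.finrank K (restrictSupport K {m : σ →₀ ℕ | m.degree = k ∧ ∀ i ∉ s, m i = 0}) =
      (s.card + k - 1).choose k := by
  have h : {m : σ →₀ ℕ | m.degree = k ∧ ∀ i ∉ s, m i = 0} = ↑(s.finsuppAntidiag k) := by
    ext m
    simp only [Set.mem_ofPred_eq, Finset.mem_coe, Finset.mem_finsuppAntidiag,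
      Finset.subset_iff, Finsupp.mem_support_iff]
    constructor
    · rintro ⟨h, h'⟩
      refine ⟨?_, fun i hi => by_contra fun hs => hi (h' i hs)⟩
      rw [← h, Finsupp.degree_eq_sum]
      exact Finset.sum_subset (Finset.subset_univ _) fun i _ hi => h' i hi
    · rintro ⟨h, h'⟩
      have h0 : ∀ i ∉ s, m i = 0 := fun i hi => by_contra fun hs => hi (h' hs)
      refine ⟨?_, h0⟩
      rw [← h, Finsupp.degree_eq_sum]
      exact (Finset.sum_subset (Finset.subset_univ _) fun i _ hi => h0 i hi).symm
  rw [h, Module.finrank_eq_card_basis (basisRestrictSupport K _)]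
  simp [Finset.card_finsuppAntidiag_nat_eq_choose]

section SetVariablesToZero

variable (P : σ → Prop) [DecidablePred P]

/-- The effect on coefficients of setting the variables in `P` to zero. -/
theorem coeff_aeval_ite_zero_X (f : MvPolynomial σ K) (m : σ →₀ ℕ) [Decidable (∀ i, P i → m i = 0)] :
    coeff m (aeval (R := K) (fun i => if P i then (0 : MvPolynomial σ K) else X i) f) =
      if ∀ i, P i → m i = 0 then coeff m f else 0 := by
  classical
  induction f using MvPolynomial.induction_on' with
  | add p q hp hq => rw [map_add, coeff_add, hp, hq, coeff_add]; split_ifs <;> simp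
  | monomial u c =>
    rw [aeval_monomial, coeff_monomial]
    by_cases hu : ∀ i, P i → u i = 0
    · have : (u.prod fun i k => (if P i then (0 : MvPolynomial σ K) else X i) ^ k) =
          u.prod fun i k => X i ^ k := by
        refine Finset.prod_congr rfl fun i hi => ?_
        dsimp only
        rw [if_neg fun h => (Finsupp.mem_support_iff.mp hi) (hu i h)]
      rw [this, algebraMap_eq, ← monomial_eq, coeff_monomial]
      split_ifs with h1 h2 <;> first | rfl | (subst h1; exact absurd hu h2)
    · push Not at hu
      obtain ⟨i, hi, hui⟩ := hu
      have : (u.prod fun i k => (if P i then (0 : MvPolynomial σ K) else X i) ^ k) = 0 :=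
        Finset.prod_eq_zero (Finsupp.mem_support_iff.mpr hui) (by simp [hi, hui])
      rw [this, mul_zero, coeff_zero]
      split_ifs with h1 h2 <;> first | rfl | (subst h2; exact absurd (h1 i hi) hui)

theorem aeval_ite_zero_X_eq_zero_iff {f : MvPolynomial σ K} {k : ℕ} (hf : f.IsHomogeneous k) :
    aeval (R := K) (fun i => if P i then (0 : MvPolynomial σ K) else X i) f = 0 ↔
      f ∈ restrictSupport K {m : σ →₀ ℕ | m.degree = k ∧ ∃ i, P i ∧ m i ≠ 0} := by
  classical
  rw [mem_restrictSupport_iff, MvPolynomial.ext_iff]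
  simp only [coeff_aeval_ite_zero_X, coeff_zero]
  constructor
  · intro h m hm
    have hm' := mem_support_iff.mp hm
    refine ⟨by_contra fun hk => hm' (hf.coeff_eq_zero hk), ?_⟩
    by_contra hP
    push Not at hP
    exact hm' ((if_pos hP).symm.trans (h m))
  · intro h m
    split_ifs with hm
    · by_contra hc
      obtain ⟨-, i, hi, hi'⟩ := h (mem_support_iff.mpr hc)
      exact hi' (hm i hi)
    · rfl

/-- If setting the variables in `P` to zero maps `V` onto all forms of degree `k` in the other
variables, then it maps the span of `x_i V` onto all forms of degree `k + 1` in them. -/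
theorem map_iSup_mulLeft_X_eq_restrictSupport (V : Submodule K (MvPolynomial σ K)) (k : ℕ)
    (hV : V.map (aeval (R := K)
        (fun i => if P i then (0 : MvPolynomial σ K) else X i)).toLinearMap =
      restrictSupport K {m : σ →₀ ℕ | m.degree = k ∧ ∀ i, P i → m i = 0}) :
    (⨆ i, V.map (LinearMap.mulLeft K (X i))).map (aeval (R := K)
        (fun i => if P i then (0 : MvPolynomial σ K) else X i)).toLinearMap =
      restrictSupport K {m : σ →₀ ℕ | m.degree = k + 1 ∧ ∀ i, P i → m i = 0} := by
  classical
  apply le_antisymm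
  · rw [Submodule.map_iSup, iSup_le_iff]
    rintro i _ ⟨_, ⟨v, hv, rfl⟩, rfl⟩
    have hv' := hV.le (Submodule.mem_map_of_mem hv)
    simp only [AlgHom.toLinearMap_apply, LinearMap.mulLeft_apply, map_mul, aeval_X] at hv' ⊢
    split_ifs with hi
    · simp
    · rw [mem_restrictSupport_iff] at hv' ⊢
      intro m hm
      rw [Finset.mem_coe, mul_comm, support_mul_X, Finset.mem_map] at hm
      obtain ⟨u, hu, rfl⟩ := hm
      obtain ⟨hu1, hu2⟩ := hv' hu
      refine ⟨by simp [hu1], fun j hj => ?_⟩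
      have : i ≠ j := fun h => hi (h ▸ hj)
      simp [hu2 j hj, this]
  · rw [restrictSupport_eq_span, Submodule.span_le]
    rintro _ ⟨m, ⟨hm, hm0⟩, rfl⟩
    have hne : m ≠ 0 := by rintro rfl; simp at hm
    obtain ⟨i, hi⟩ := Finsupp.ne_iff.mp hne
    have hle : Finsupp.single i 1 ≤ m := by
      simpa [Finsupp.single_le_iff, Nat.one_le_iff_ne_zero] using hi
    have hadd : m - Finsupp.single i 1 + Finsupp.single i 1 = m := tsub_add_cancel_of_le hle
    have hmem : (monomial (m - Finsupp.single i 1) 1 : MvPolynomial σ K) ∈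
        restrictSupport K {m : σ →₀ ℕ | m.degree = k ∧ ∀ i, P i → m i = 0} := by
      refine (monomial_mem_restrictSupport ..).mpr (Or.inl ⟨?_, fun j hj => by simp [hm0 j hj]⟩)
      have := congrArg Finsupp.degree hadd
      simp only [map_add, Finsupp.degree_single, hm] at this
      omega
    obtain ⟨v, hv, hvm⟩ := hV.ge hmem
    refine ⟨X i * v, Submodule.mem_iSup_of_mem i ⟨v, hv, rfl⟩, ?_⟩
    have hPi : ¬ P i := fun h => hi (hm0 i h)
    simp only [AlgHom.toLinearMap_apply] at hvm ⊢
    rw [map_mul, hvm, aeval_X, if_neg hPi, X, monomial_mul, add_comm, hadd, one_mul]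

end SetVariablesToZero

theorem iSup_map_mulLeft_X_le_homogeneousSubmodule {V : Submodule K (MvPolynomial σ K)} {k : ℕ}
    (hV : V ≤ homogeneousSubmodule σ K k) :
    ⨆ i, V.map (LinearMap.mulLeft K (X i)) ≤ homogeneousSubmodule σ K (k + 1) := by
  rw [iSup_le_iff]
  rintro i _ ⟨v, hv, rfl⟩
  have := (isHomogeneous_X K i).mul (hV hv)
  rwa [add_comm] at this

end MvPolynomial

theorem Submodule.finrank_map_add_finrank_inf_ker {K M N : Type*} [Field K] [AddCommGroup M]
    [Module K M] [AddCommGroup N] [Module K N] (f : M →ₗ[K] N) (S : Submodule K M)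
    [FiniteDimensional K S] :
    Module.finrank K (S.map f) + Module.finrank K ↥(S ⊓ LinearMap.ker f) =
      Module.finrank K S := by
  rw [← LinearMap.finrank_range_add_finrank_ker (f.domRestrict S), LinearMap.range_domRestrict,
    LinearMap.ker_domRestrict, ← Submodule.map_comap_subtype, Submodule.finrank_map_subtype_eq]

/-- Let `p(t)` be an admissible Hilbert polynomial of degree `d` with Gotzmann number
`r = s+1`, `q(t) = C(n+t,n) − p(t)` and `q'(t) = q(t) − C(n−d−1+t, n−d−1)`.  Let
`V ⊆ K[x_0, …, x_n]_r` be a `q(r)`-dimensional subspace projecting onto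
`K[x_{d+1}, …, x_n]_r` under `x_0 = … = x_d = 0`, set `W = x_0·V + ⋯ + x_d·V` and assume
`dim_K W ≥ q'(r+1)`.  Then `dim_K(K[x]_1·V) = q(r+1)` if and only if
`dim_K W = q'(r+1)` and `(K[x]_1·V) ∩ (x_0, …, x_d)_{r+1} = W`. -/
theorem stmt_16 {K : Type*} [Field K] [CharZero K]
    (n s d : ℕ) (a : Fin (s + 1) → ℕ) (ha : Antitone a) (had : a 0 = d) (hdn : d < n)
    (p q q' : ℕ → ℕ)
    (hp : ∀ t, p t = ∑ i : Fin (s + 1), Nat.choose (t + a i - (i : ℕ)) (a i))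
    (hq : ∀ t, q t = Nat.choose (n + t) n - p t)
    (hq' : ∀ t, q' t = q t - Nat.choose (n - d - 1 + t) (n - d - 1))
    (r : ℕ) (hr : r = s + 1)
    (V : Submodule K (MvPolynomial (Fin (n + 1)) K))
    (hV : V ≤ homogeneousSubmodule (Fin (n + 1)) K r)
    (hdim : Module.finrank K V = q r)
    (hsurj : V.map (MvPolynomial.aeval (R := K)
        (fun i : Fin (n + 1) =>
          if (i : ℕ) ≤ d then (0 : MvPolynomial (Fin (n + 1)) K) else X i)).toLinearMap
      = Submodule.span K {x : MvPolynomial (Fin (n + 1)) K |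
          ∃ m : Fin (n + 1) →₀ ℕ, m.degree = r ∧
            (∀ i : Fin (n + 1), (i : ℕ) ≤ d → m i = 0) ∧ x = monomial m 1})
    (W : Submodule K (MvPolynomial (Fin (n + 1)) K))
    (hW : W = ⨆ i ∈ Finset.filter (fun i : Fin (n + 1) => (i : ℕ) ≤ d) Finset.univ,
        V.map (LinearMap.mulLeft K (X i)))
    (hWdim : q' (r + 1) ≤ Module.finrank K W) :
    Module.finrank K ↥(⨆ i : Fin (n + 1), V.map (LinearMap.mulLeft K (X i))) = q (r + 1)
      ↔ Module.finrank K W = q' (r + 1)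
        ∧ (⨆ i : Fin (n + 1), V.map (LinearMap.mulLeft K (X i)))
            ⊓ Submodule.span K {x : MvPolynomial (Fin (n + 1)) K |
                ∃ m : Fin (n + 1) →₀ ℕ, m.degree = r + 1 ∧
                  (∃ i : Fin (n + 1), (i : ℕ) ≤ d ∧ m i ≠ 0) ∧ x = monomial m 1}
          = W := by
  classical
  have hset (k : ℕ) : restrictSupport K {m : Fin (n + 1) →₀ ℕ |
      m.degree = k ∧ ∀ i : Fin (n + 1), (i : ℕ) ≤ d → m i = 0} =
      Submodule.span K {x : MvPolynomial (Fin (n + 1)) K |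
          ∃ m : Fin (n + 1) →₀ ℕ, m.degree = k ∧
            (∀ i : Fin (n + 1), (i : ℕ) ≤ d → m i = 0) ∧ x = monomial m 1} := by
    rw [restrictSupport_eq_span]
    congr 1
    ext x
    simp only [Set.mem_image, Set.mem_ofPred_eq, and_assoc, eq_comm]
  have hsetI : Submodule.span K {x : MvPolynomial (Fin (n + 1)) K |
      ∃ m : Fin (n + 1) →₀ ℕ, m.degree = r + 1 ∧
        (∃ i : Fin (n + 1), (i : ℕ) ≤ d ∧ m i ≠ 0) ∧ x = monomial m 1} =
      restrictSupport K {m : Fin (n + 1) →₀ ℕ |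
        m.degree = r + 1 ∧ ∃ i : Fin (n + 1), (i : ℕ) ≤ d ∧ m i ≠ 0} := by
    rw [restrictSupport_eq_span]
    congr 1
    ext x
    simp only [Set.mem_image, Set.mem_ofPred_eq, and_assoc, eq_comm]
  rw [hsetI]
  rw [← hset] at hsurj
  have hmap := map_iSup_mulLeft_X_eq_restrictSupport (fun i : Fin (n + 1) => (i : ℕ) ≤ d) V r hsurj
  have hhom := iSup_map_mulLeft_X_le_homogeneousSubmodule hV
  set S := ⨆ i : Fin (n + 1), V.map (LinearMap.mulLeft K (X i))
  have : FiniteDimensional K (homogeneousSubmodule (Fin (n + 1)) K (r + 1)) :=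
    Module.Finite.iff_fg.mpr (homogeneousSubmodule_fg _ _ _)
  have : FiniteDimensional K S := Submodule.finiteDimensional_of_le hhom
  have hker : S ⊓ LinearMap.ker (aeval (R := K) (fun i : Fin (n + 1) =>
      if (i : ℕ) ≤ d then (0 : MvPolynomial (Fin (n + 1)) K) else X i)).toLinearMap =
      S ⊓ restrictSupport K {m : Fin (n + 1) →₀ ℕ |
        m.degree = r + 1 ∧ ∃ i : Fin (n + 1), (i : ℕ) ≤ d ∧ m i ≠ 0} := by
    ext f
    simp only [Submodule.mem_inf]
    exact and_congr_right fun hf => aeval_ite_zero_X_eq_zero_iff _ (hhom hf)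
  have hrank := Submodule.finrank_map_add_finrank_inf_ker (aeval (R := K)
    (fun i : Fin (n + 1) =>
      if (i : ℕ) ≤ d then (0 : MvPolynomial (Fin (n + 1)) K) else X i)).toLinearMap S
  have hcount : Module.finrank K (restrictSupport K {m : Fin (n + 1) →₀ ℕ |
      m.degree = r + 1 ∧ ∀ i : Fin (n + 1), (i : ℕ) ≤ d → m i = 0}) =
      (n - d - 1 + (r + 1)).choose (n - d - 1) := by
    have hvars : {m : Fin (n + 1) →₀ ℕ |
        m.degree = r + 1 ∧ ∀ i : Fin (n + 1), (i : ℕ) ≤ d → m i = 0} =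
        {m : Fin (n + 1) →₀ ℕ | m.degree = r + 1 ∧
          ∀ i ∉ Finset.univ.filter fun i : Fin (n + 1) => ¬ (i : ℕ) ≤ d, m i = 0} := by
      ext m
      simp
    have hcard : (Finset.univ.filter fun i : Fin (n + 1) => ¬ (i : ℕ) ≤ d).card = n - d := by
      have : (Finset.univ.filter fun i : Fin (n + 1) => ¬ (i : ℕ) ≤ d) =
          Finset.Ioi ⟨d, by omega⟩ := by
        ext i
        simp [Fin.lt_def]
      rw [this, Fin.card_Ioi]
      dsimp only
      omega
    rw [hvars, finrank_restrictSupport_degree_eq, hcard, Nat.choose_symm_add]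
    congr 1
    omega
  rw [hker, hmap, hcount] at hrank
  have hWle : W ≤ S ⊓ restrictSupport K {m : Fin (n + 1) →₀ ℕ |
      m.degree = r + 1 ∧ ∃ i : Fin (n + 1), (i : ℕ) ≤ d ∧ m i ≠ 0} := by
    rw [← hker, hW, iSup₂_le_iff]
    rintro i hi _ ⟨v, hv, rfl⟩
    refine ⟨Submodule.mem_iSup_of_mem i ⟨v, hv, rfl⟩, ?_⟩
    simp only [Finset.mem_filter, Finset.mem_univ, true_and] at hi
    simp [hi]
  set T := S ⊓ restrictSupport K {m : Fin (n + 1) →₀ ℕ |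
      m.degree = r + 1 ∧ ∃ i : Fin (n + 1), (i : ℕ) ≤ d ∧ m i ≠ 0}
  have : FiniteDimensional K T := Submodule.finiteDimensional_of_le inf_le_left
  have : FiniteDimensional K W := Submodule.finiteDimensional_of_le hWle
  have hWT := Submodule.finrank_mono hWle
  have hWpos : 0 < Module.finrank K W := by
    rw [Module.finrank_pos_iff, Submodule.nontrivial_iff_ne_bot]
    have hmem : (monomial (Finsupp.single (Fin.last n) r) 1 : MvPolynomial (Fin (n + 1)) K) ∈
        restrictSupport K {m : Fin (n + 1) →₀ ℕ |
          m.degree = r ∧ ∀ i : Fin (n + 1), (i : ℕ) ≤ d → m i = 0} := by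
      refine (monomial_mem_restrictSupport ..).mpr (Or.inl ⟨by simp, fun i hi => ?_⟩)
      refine Finsupp.single_eq_of_ne fun h => ?_
      simp [h] at hi
      omega
    obtain ⟨v, hv, hvm⟩ := hsurj.ge hmem
    have hv0 : v ≠ 0 := by
      rintro rfl
      rw [map_zero, eq_comm, monomial_eq_zero] at hvm
      exact one_ne_zero hvm
    refine (Submodule.ne_bot_iff _).mpr ⟨X 0 * v, ?_, mul_ne_zero (X_ne_zero 0) hv0⟩
    rw [hW]
    exact Submodule.mem_iSup_of_mem 0 (Submodule.mem_iSup_of_mem (by simp) ⟨v, hv, rfl⟩)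
  have hq'r := hq' (r + 1)
  constructor
  · intro h
    have hd : Module.finrank K W = Module.finrank K T := by omega
    exact ⟨by omega, (Submodule.eq_of_le_of_finrank_eq hWle hd).symm⟩
  · rintro ⟨h1, h2⟩
    rw [h2] at hrank
    omega
end
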